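/- arXiv:1205.5955 — 3 statements merged into one kernel-verified Lean document; each statement's English description precedes it below -/
import Mathlib

section
/- Let (ρ_j)_{j∈ℕ} be a sequence of complex numbers and let C > 0, p > 0 be constants such that #{j : |ρ_j| ≤ R} ≤ C·R^p for every R ≥ 1. Assume moreover that there is c > 0 with Im(ρ_j) ≥ 1 + c·log(1+|ρ_j|) for every j. Then for every real t with c·|t| > p, the series ∑_j e^{−Im(ρ_j)·|t|} converges and satisfies ∑_j e^{−Im(ρ_j)·|t|} ≤ C·e^{−|t|}·(c|t| + c|t|/(c|t|−p)). -/
open MeasureTheory Set in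
/-- Partial summation: a polynomial bound on the counting function of a finite family of reals
`≥ 1` bounds the sum of their powers of exponent `-a`. -/
theorem sum_rpow_neg_le_of_card_filter_le {ι : Type*} (s : Finset ι) (y : ι → ℝ)
    (hy : ∀ j ∈ s, 1 ≤ y j) {C p a : ℝ} (ha : 0 < a) (hpa : p < a)
    (hcard : ∀ r : ℝ, 1 ≤ r → ((s.filter fun j => y j < r).card : ℝ) ≤ C * r ^ p) :
    ∑ j ∈ s, y j ^ (-a) ≤ C * (a / (a - p)) := by
  have integral_tail : ∀ j ∈ s, y j ^ (-a) =
      ∫ r in Ioi (1 : ℝ), (Ioi (y j)).indicator (fun r => a * r ^ (-a - 1)) r := by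
    intro j hj
    have h1 := hy j hj
    rw [setIntegral_indicator measurableSet_Ioi, Ioi_inter_Ioi, max_eq_right h1,
      integral_const_mul, integral_Ioi_rpow_of_lt (by linarith) (by linarith)]
    rw [sub_add_cancel]
    field_simp
  have integrable_tail : ∀ b : ℝ, b < -1 → IntegrableOn (fun r : ℝ => r ^ b) (Ioi 1) :=
    fun b hb => integrableOn_Ioi_rpow_of_lt hb one_pos
  have integrable_indicator : ∀ j ∈ s, IntegrableOn
      ((Ioi (y j)).indicator fun r : ℝ => a * r ^ (-a - 1)) (Ioi 1) := fun j _ =>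
    Integrable.indicator ((integrable_tail (-a - 1) (by linarith)).const_mul a)
      measurableSet_Ioi
  rw [Finset.sum_congr rfl integral_tail, ← integral_finsetSum s integrable_indicator]
  calc ∫ r in Ioi (1 : ℝ), ∑ j ∈ s, (Ioi (y j)).indicator (fun r => a * r ^ (-a - 1)) r
      ≤ ∫ r in Ioi (1 : ℝ), C * a * r ^ (p - a - 1) := by
        refine setIntegral_mono_on (integrable_finsetSum s integrable_indicator)
          ((integrable_tail _ (by linarith)).const_mul _) measurableSet_Ioi fun r hr => ?_
        have hr : 1 < r := hr
        have hr0 : 0 < r := by linarith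
        simp only [indicator_apply, mem_Ioi]
        rw [← Finset.sum_filter, Finset.sum_const, nsmul_eq_mul]
        calc _ ≤ C * r ^ p * (a * r ^ (-a - 1)) := by
              gcongr
              exact hcard r hr.le
          _ = C * a * (r ^ p * r ^ (-a - 1)) := by ring
          _ = _ := by
              rw [← Real.rpow_add hr0]
              ring_nf
    _ = C * (a / (a - p)) := by
        rw [integral_const_mul, integral_Ioi_rpow_of_lt (by linarith) one_pos, Real.one_rpow,
          sub_add_cancel, ← neg_sub a p, neg_div_neg_eq]
        ring

/-- Estimate on the sum over resonances above the logarithmic curve: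
if `#{j : |ρ j| ≤ R} ≤ C R^p` and `Im ρ_j ≥ 1 + c log(1+|ρ_j|)`, then for `c|t| > p`
the series `∑ e^{-Im(ρ_j)|t|}` converges with the stated bound. -/
theorem stmt_3 (ρ : ℕ → ℂ) (C p : ℝ) (hC : 0 < C) (hp : 0 < p)
    (hcount : ∀ R : ℝ, 1 ≤ R → {j | ‖ρ j‖ ≤ R}.Finite ∧
      (Nat.card {j | ‖ρ j‖ ≤ R} : ℝ) ≤ C * R ^ p)
    (c : ℝ) (hc : 0 < c)
    (him : ∀ j, 1 + c * Real.log (1 + ‖ρ j‖) ≤ (ρ j).im)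
    (t : ℝ) (ht : p < c * |t|) :
    Summable (fun j => Real.exp (-(ρ j).im * |t|)) ∧
      ∑' j, Real.exp (-(ρ j).im * |t|) ≤
        C * Real.exp (-|t|) * (c * |t| + c * |t| / (c * |t| - p)) := by
  have ha : 0 < c * |t| := hp.trans ht
  have term_le : ∀ j, Real.exp (-(ρ j).im * |t|) ≤
      Real.exp (-|t|) * (max 1 ‖ρ j‖) ^ (-(c * |t|)) := by
    intro j
    have hpos : (0 : ℝ) < max 1 ‖ρ j‖ := one_pos.trans_le (le_max_left _ _)
    have hlog : Real.log (max 1 ‖ρ j‖) ≤ Real.log (1 + ‖ρ j‖) :=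
      Real.log_le_log hpos (max_le (by linarith [norm_nonneg (ρ j)]) (by linarith))
    rw [Real.rpow_def_of_pos hpos, ← Real.exp_add, Real.exp_le_exp]
    have h1 := mul_le_mul_of_nonneg_right (him j) (abs_nonneg t)
    have h2 := mul_le_mul_of_nonneg_left hlog ha.le
    linarith
  have sum_le : ∀ s : Finset ℕ, ∑ j ∈ s, Real.exp (-(ρ j).im * |t|) ≤
      C * Real.exp (-|t|) * (c * |t| + c * |t| / (c * |t| - p)) := by
    intro s
    have hsum : ∑ j ∈ s, (max 1 ‖ρ j‖) ^ (-(c * |t|)) ≤ C * (c * |t| / (c * |t| - p)) := by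
      refine sum_rpow_neg_le_of_card_filter_le s _ (fun j _ => le_max_left _ _) ha ht
        fun r hr => ?_
      obtain ⟨hfin, hle⟩ := hcount r hr
      refine le_trans ?_ hle
      rw [Nat.card_coe_set_eq, ← Set.ncard_coe_finset]
      refine Nat.cast_le.mpr (Set.ncard_le_ncard (fun j hj => ?_) hfin)
      have hlt := (Finset.mem_filter.mp (Finset.mem_coe.mp hj)).2
      exact (le_max_right 1 ‖ρ j‖).trans hlt.le
    calc ∑ j ∈ s, Real.exp (-(ρ j).im * |t|)
        ≤ Real.exp (-|t|) * ∑ j ∈ s, (max 1 ‖ρ j‖) ^ (-(c * |t|)) := by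
          rw [Finset.mul_sum]
          exact Finset.sum_le_sum fun j _ => term_le j
      _ ≤ Real.exp (-|t|) * (C * (c * |t| / (c * |t| - p))) := by gcongr
      _ = C * Real.exp (-|t|) * (c * |t| / (c * |t| - p)) := by ring
      _ ≤ _ := by
          gcongr
          linarith
  exact ⟨summable_of_sum_le (fun j => (Real.exp_pos _).le) sum_le,
    Real.tsum_le_of_sum_le (fun j => (Real.exp_pos _).le) sum_le⟩
end

section
/- Let v : ℝ → ℂ be integrable and suppose that t ↦ v(t)/t is also integrable on ℝ. Then for every z ∈ ℝ, ∫₀^z ( ∫_ℝ v(t)·e^{−iwt} dt ) dw = i·( ∫_ℝ (v(t)/t)·e^{−izt} dt − ∫_ℝ v(t)/t dt ). In particular, the left-hand side is a bounded function of z ∈ ℝ. -/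
open MeasureTheory

lemma norm_exp_neg_I_mul_ofReal_mul_ofReal (w t : ℝ) :
    ‖Complex.exp (-Complex.I * (w : ℂ) * (t : ℂ))‖ = 1 := by
  simp [Complex.norm_exp]

/-- Multiplying an integrable function by the Fourier character keeps it integrable. -/
lemma MeasureTheory.Integrable.mul_exp_neg_I {u : ℝ → ℂ} (hu : Integrable u) (z : ℝ) :
    Integrable (fun t : ℝ => u t * Complex.exp (-Complex.I * (z : ℂ) * (t : ℂ))) :=
  hu.mul_bdd (c := 1) (by fun_prop)
    (.of_forall fun t => (norm_exp_neg_I_mul_ofReal_mul_ofReal z t).le)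

/-- The primitive in the frequency variable of the Fourier character. -/
lemma intervalIntegral_exp_neg_I_mul {t : ℝ} (ht : t ≠ 0) (z : ℝ) :
    ∫ w in (0:ℝ)..z, Complex.exp (-Complex.I * (w : ℂ) * (t : ℂ)) =
      Complex.I * ((Complex.exp (-Complex.I * (z : ℂ) * (t : ℂ)) - 1) / (t : ℂ)) := by
  have htc : (t : ℂ) ≠ 0 := by exact_mod_cast ht
  have hc : -Complex.I * (t : ℂ) ≠ 0 := mul_ne_zero (neg_ne_zero.mpr Complex.I_ne_zero) htc
  have h := integral_exp_mul_complex (a := 0) (b := z) hc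
  simp only [mul_right_comm _ (t : ℂ)] at h
  rw [h, div_eq_iff hc]
  simp only [Complex.ofReal_zero, mul_zero, zero_mul, Complex.exp_zero]
  field_simp
  linear_combination (Complex.exp (-(Complex.I * z * t)) - 1) * Complex.I_sq

/-- The primitive of the Fourier transform of `v`, through the Fourier transform of `v t / t`. -/
lemma intervalIntegral_fourier_eq {v : ℝ → ℂ} (hv : Integrable v)
    (hv2 : Integrable (fun t : ℝ => v t / (t : ℂ))) (z : ℝ) :
    (∫ w in (0:ℝ)..z, (∫ t : ℝ, v t * Complex.exp (-Complex.I * (w : ℂ) * (t : ℂ)))) =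
      Complex.I * ((∫ t : ℝ, (v t / (t : ℂ)) * Complex.exp (-Complex.I * (z : ℂ) * (t : ℂ))) -
        ∫ t : ℝ, v t / (t : ℂ)) := by
  have : IsFiniteMeasure (volume.restrict (Set.uIoc 0 z)) := by
    rw [Set.uIoc]
    infer_instance
  have hint : Integrable
      (Function.uncurry fun w t : ℝ => v t * Complex.exp (-Complex.I * (w : ℂ) * (t : ℂ)))
      ((volume.restrict (Set.uIoc 0 z)).prod volume) :=
    (hv.comp_snd _).mul_bdd (c := 1) (by fun_prop)
      (.of_forall fun p => (norm_exp_neg_I_mul_ofReal_mul_ofReal p.1 p.2).le)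
  rw [intervalIntegral_integral_swap hint, ← integral_sub (hv2.mul_exp_neg_I z) hv2,
    ← integral_const_mul]
  refine integral_congr_ae ?_
  filter_upwards [compl_mem_ae_iff.mpr (measure_singleton (0 : ℝ))] with t ht
  rw [intervalIntegral.integral_const_mul, intervalIntegral_exp_neg_I_mul ht]
  ring

/-- If `v` and `t ↦ v(t)/t` are integrable on `ℝ`, then the primitive of the Fourier
transform of `v` satisfies `∫₀^z v̂(w) dw = i (F(v/t)(z) - ∫ v/t)`; in particular it is a
bounded function of `z`. -/
theorem stmt_13 (v : ℝ → ℂ) (hv : Integrable v)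
    (hv2 : Integrable (fun t : ℝ => v t / (t : ℂ))) :
    (∀ z : ℝ, (∫ w in (0:ℝ)..z, (∫ t : ℝ, v t * Complex.exp (-Complex.I * (w : ℂ) * (t : ℂ)))) =
      Complex.I * ((∫ t : ℝ, (v t / (t : ℂ)) * Complex.exp (-Complex.I * (z : ℂ) * (t : ℂ))) -
        ∫ t : ℝ, v t / (t : ℂ))) ∧
    ∃ C : ℝ, ∀ z : ℝ, norm
      (∫ w in (0:ℝ)..z, (∫ t : ℝ, v t * Complex.exp (-Complex.I * (w : ℂ) * (t : ℂ)))) ≤ C := by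
  refine ⟨intervalIntegral_fourier_eq hv hv2,
    (∫ t : ℝ, ‖v t / (t : ℂ)‖) + ‖∫ t : ℝ, v t / (t : ℂ)‖, fun z => ?_⟩
  rw [intervalIntegral_fourier_eq hv hv2 z, norm_mul, Complex.norm_I, one_mul]
  refine (norm_sub_le _ _).trans
    (add_le_add_left ((norm_integral_le_integral_norm _).trans_eq ?_) _)
  simp only [norm_mul, norm_exp_neg_I_mul_ofReal_mul_ofReal, mul_one]
end

section
/- Let L ∈ ℝ and let σ : ℝ → ℂ be infinitely differentiable, with, for every k ∈ ℕ, a constant C_k > 0 such that |σ^{(k)}(z)| ≤ C_k·(1+|z|)^{L−k} for all z ∈ ℝ. Let ψ : ℝ → ℂ be measurable with ∫_ℝ (1+|w|)^N·|ψ(w)| dw < ∞ for every N, ∫_ℝ ψ(w) dw = 2π, and ∫_ℝ w^k·ψ(w) dw = 0 for every integer k ≥ 1. Then for every K ∈ ℕ there is a constant C'_K > 0 such that |2π·σ(z) − ∫_ℝ σ(z−w)·ψ(w) dw| ≤ C'_K·(1+|z|)^{L−K} for every z ∈ ℝ. -/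
open MeasureTheory

/-- **Peetre's inequality**, for weights `1 + |·|` on the real line. -/
theorem one_add_abs_add_rpow_le (s z u : ℝ) :
    (1 + |z + u|) ^ s ≤ (1 + |z|) ^ s * (1 + |u|) ^ |s| := by
  have hz : 0 < 1 + |z| := by positivity
  have hu : 0 < 1 + |u| := by positivity
  have hzu : 0 < 1 + |z + u| := by positivity
  rcases le_total 0 s with hs | hs
  · rw [abs_of_nonneg hs, ← Real.mul_rpow hz.le hu.le]
    refine Real.rpow_le_rpow hzu.le ?_ hs
    nlinarith [abs_add_le z u, mul_nonneg (abs_nonneg z) (abs_nonneg u)]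
  · have h : 1 + |z| ≤ (1 + |z + u|) * (1 + |u|) := by
      have h1 : |z| ≤ |z + u| + |u| := by simpa using abs_sub (z + u) u
      nlinarith [mul_nonneg (abs_nonneg (z + u)) (abs_nonneg u)]
    have h2 := Real.rpow_le_rpow_of_nonpos hz h hs
    rw [Real.mul_rpow hzu.le hu.le] at h2
    calc (1 + |z + u|) ^ s = (1 + |z + u|) ^ s * (1 + |u|) ^ s * (1 + |u|) ^ |s| := by
          rw [abs_of_nonpos hs, mul_assoc, ← Real.rpow_add hu]; simp
      _ ≤ _ := by gcongr

/-- Taylor's theorem along the segment from `z` to `z + h`, with a bound on the remainder. -/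
theorem norm_sub_taylor_sum_le {E : Type*} [NormedAddCommGroup E] [NormedSpace ℝ E] {f : ℝ → E}
    {n : ℕ} (hf : ContDiff ℝ (n + 1) f) (z h : ℝ) {B : ℝ}
    (hB : ∀ t ∈ Set.Icc (0 : ℝ) 1, ‖iteratedDeriv (n + 1) f (z + h * t)‖ ≤ B) :
    ‖f (z + h) - ∑ k ∈ Finset.range (n + 1),
      ((k.factorial : ℝ)⁻¹ * h ^ k) • iteratedDeriv k f z‖ ≤ |h| ^ (n + 1) * B := by
  have hB0 : 0 ≤ B := (norm_nonneg _).trans (hB 0 (by simp))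
  have hfz : ContDiff ℝ (n + 1) (fun t => f (z + t)) := hf.comp (contDiff_const.add contDiff_id)
  have hg : ContDiff ℝ (n + 1) (fun t => f (z + h * t)) :=
    hfz.comp (contDiff_const.mul contDiff_id)
  have hd : ∀ k ≤ n + 1, ∀ t ∈ Set.Icc (0 : ℝ) 1,
      iteratedDerivWithin k (fun t => f (z + h * t)) (Set.Icc 0 1) t =
        h ^ k • iteratedDeriv k f (z + h * t) := by
    intro k hk t ht
    have hk' : (k : WithTop ℕ∞) ≤ n + 1 := by exact_mod_cast hk
    rw [iteratedDerivWithin_eq_iteratedDeriv (uniqueDiffOn_Icc zero_lt_one)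
      (hg.of_le hk').contDiffAt ht, iteratedDeriv_comp_const_smul (hfz.of_le hk') h,
      iteratedDeriv_comp_const_add]
  have key := taylor_mean_remainder_bound (f := fun t => f (z + h * t)) (n := n)
    (C := |h| ^ (n + 1) * B) zero_le_one hg.contDiffOn (Set.right_mem_Icc.2 zero_le_one) (by
      intro t ht
      rw [hd _ le_rfl t ht, norm_smul, norm_pow, Real.norm_eq_abs]
      gcongr
      exact hB t ht)
  rw [taylor_within_apply] at key
  have hsum : ∑ k ∈ Finset.range (n + 1), ((k.factorial : ℝ)⁻¹ * (1 - 0) ^ k) •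
      iteratedDerivWithin k (fun t => f (z + h * t)) (Set.Icc 0 1) 0 =
      ∑ k ∈ Finset.range (n + 1), ((k.factorial : ℝ)⁻¹ * h ^ k) • iteratedDeriv k f z := by
    refine Finset.sum_congr rfl fun k hk => ?_
    rw [hd k (Finset.mem_range.1 hk).le 0 (by simp), smul_smul]
    simp
  rw [hsum] at key
  simp only [mul_one, sub_zero, one_pow] at key
  refine key.trans (div_le_self (by positivity) ?_)
  exact_mod_cast Nat.one_le_iff_ne_zero.2 n.factorial_ne_zero

/-- Convolution of a symbol of order `L` against a function all of whose higher moments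
vanish (and with total mass `2π`) reproduces `2π σ` up to `O((1+|z|)^{L-K})` for every `K`. -/
theorem stmt_15 (L : ℝ) (σ : ℝ → ℂ) (hσ : ContDiff ℝ (⊤ : ℕ∞) σ)
    (hderiv : ∀ k : ℕ, ∃ Ck : ℝ, 0 < Ck ∧ ∀ z : ℝ,
      ‖iteratedDeriv k σ z‖ ≤ Ck * (1 + |z|) ^ (L - (k : ℝ)))
    (ψ : ℝ → ℂ) (hψmeas : Measurable ψ)
    (hψint : ∀ N : ℕ, Integrable (fun w : ℝ => (1 + |w|) ^ N * ‖ψ w‖))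
    (hψ0 : (∫ w : ℝ, ψ w) = ((2 * Real.pi : ℝ) : ℂ))
    (hmom : ∀ k : ℕ, 1 ≤ k → (∫ w : ℝ, (w : ℂ) ^ k * ψ w) = 0) :
    ∀ K : ℕ, ∃ C' : ℝ, 0 < C' ∧ ∀ z : ℝ,
      ‖((2 * Real.pi : ℝ) : ℂ) * σ z - ∫ w : ℝ, σ (z - w) * ψ w‖ ≤
        C' * (1 + |z|) ^ (L - (K : ℝ)) := by
  intro K
  obtain ⟨C, hC, hCb⟩ := hderiv (K + 1)
  set s : ℝ := L - ((K + 1 : ℕ) : ℝ) with hs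
  set N : ℕ := K + 1 + ⌈|s|⌉₊ with hN
  have hpow : ∀ k : ℕ, Integrable (fun w : ℝ => (w : ℂ) ^ k * ψ w) := fun k => by
    refine (hψint k).mono' (by fun_prop) (.of_forall fun w => ?_)
    rw [norm_mul, norm_pow, Complex.norm_real, Real.norm_eq_abs]
    gcongr
    linarith
  set P : ℝ → ℝ → ℂ := fun z w => ∑ k ∈ Finset.range (K + 1),
    ((k.factorial : ℝ)⁻¹ * (-w) ^ k) • iteratedDeriv k σ z with hP
  have hPeq : ∀ z w, P z w * ψ w = ∑ k ∈ Finset.range (K + 1),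
      ((k.factorial : ℂ)⁻¹ * (-1) ^ k * iteratedDeriv k σ z) * ((w : ℂ) ^ k * ψ w) := by
    intro z w
    rw [hP, Finset.sum_mul]
    refine Finset.sum_congr rfl fun k _ => ?_
    rw [Complex.real_smul, neg_pow]
    push_cast
    ring
  have hPint : ∀ z, Integrable (fun w => P z w * ψ w) := by
    intro z
    simp only [hPeq]
    exact integrable_finsetSum _ fun k _ => (hpow k).const_mul _
  have hPval : ∀ z, ∫ w, P z w * ψ w = ((2 * Real.pi : ℝ) : ℂ) * σ z := by
    intro z
    simp only [hPeq]
    rw [integral_finsetSum _ fun k _ => (hpow k).const_mul _]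
    simp only [integral_const_mul]
    rw [Finset.sum_eq_single_of_mem 0 (by simp)
      fun k _ hk => by rw [hmom k (Nat.one_le_iff_ne_zero.2 hk), mul_zero]]
    simp only [pow_zero, one_mul, hψ0, iteratedDeriv_zero, Nat.factorial_zero, Nat.cast_one,
      inv_one]
    ring
  have hR : ∀ z w, ‖(σ (z - w) - P z w) * ψ w‖ ≤
      C * (1 + |z|) ^ s * ((1 + |w|) ^ N * ‖ψ w‖) := by
    intro z w
    have h1 := norm_sub_taylor_sum_le (n := K) (f := σ) (hσ.of_le (by exact_mod_cast le_top)) z (-w)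
      (B := C * ((1 + |z|) ^ s * (1 + |w|) ^ |s|)) (by
        intro t ht
        have hwt : |-w * t| ≤ |w| := by
          rw [abs_mul, abs_neg, abs_of_nonneg ht.1]
          exact mul_le_of_le_one_right (abs_nonneg w) ht.2
        refine (hCb _).trans ?_
        gcongr
        refine (one_add_abs_add_rpow_le s z (-w * t)).trans ?_
        gcongr ?_ * (1 + ?_) ^ _)
    rw [← sub_eq_add_neg, abs_neg] at h1
    have h2 : (1 + |w|) ^ |s| ≤ (1 + |w|) ^ ⌈|s|⌉₊ := by
      rw [← Real.rpow_natCast]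
      exact Real.rpow_le_rpow_of_exponent_le (by simp) (Nat.le_ceil _)
    rw [norm_mul, ← mul_assoc]
    gcongr
    calc _ ≤ |w| ^ (K + 1) * (C * ((1 + |z|) ^ s * (1 + |w|) ^ |s|)) := h1
      _ ≤ (1 + |w|) ^ (K + 1) * (C * ((1 + |z|) ^ s * (1 + |w|) ^ ⌈|s|⌉₊)) := by
          gcongr
          linarith
      _ = _ := by rw [hN, pow_add]; ring
  have hσc : Continuous σ := hσ.continuous
  have hRint : ∀ z, Integrable (fun w => (σ (z - w) - P z w) * ψ w) := fun z =>
    ((hψint N).const_mul (C * (1 + |z|) ^ s)).mono' (by fun_prop) (.of_forall (hR z))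
  set I : ℝ := ∫ w, (1 + |w|) ^ N * ‖ψ w‖
  have hI : 0 ≤ I := integral_nonneg fun w => by positivity
  refine ⟨C * (I + 1), by positivity, fun z => ?_⟩
  have hsplit : ((2 * Real.pi : ℝ) : ℂ) * σ z - ∫ w, σ (z - w) * ψ w =
      -∫ w, (σ (z - w) - P z w) * ψ w := by
    have h : ∫ w, σ (z - w) * ψ w =
        (∫ w, (σ (z - w) - P z w) * ψ w) + ∫ w, P z w * ψ w := by
      rw [← integral_add (hRint z) (hPint z)]
      congr 1 with w
      ring
    rw [h, hPval]
    ring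
  rw [hsplit, norm_neg]
  calc ‖∫ w, (σ (z - w) - P z w) * ψ w‖
      ≤ ∫ w, C * (1 + |z|) ^ s * ((1 + |w|) ^ N * ‖ψ w‖) :=
        norm_integral_le_of_norm_le ((hψint N).const_mul _) (.of_forall (hR z))
    _ = C * I * (1 + |z|) ^ s := by rw [integral_const_mul]; ring
    _ ≤ C * (I + 1) * (1 + |z|) ^ (L - (K : ℝ)) := by
        gcongr
        · linarith
        · simp
        · rw [hs]
          push_cast
          linarith
end
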